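/- Let f : ℝ^d → ℝ be twice continuously differentiable, bounded below, and satisfy the local PL condition at a local minimizer x*. Assume there exist constants 0 < μ ≤ L such that in some neighborhood of x*, every nonzero eigenvalue of the Hessian ∇²f(x') lies in [μ, L] for every x' ∈ 𝒮 in that neighborhood. Then for every sufficiently small ε > 0 there exist an open neighborhood U of x* and a constant C_ε > 0 such that, with the optimal parameter choice α = 4/(3L+μ) and β = (√(3L+μ) − 2√μ)/(√(3L+μ) + 2√μ), for all initial points x⁰, x¹ ∈ U the NAG iterates converge to some local minimizer x' ∈ 𝒮 with ‖xⁿ − x'‖ ≤ C_ε (‖x¹ − x'‖ + ‖x⁰ − x'‖) ((√(3L+μ) − 2√μ)/√(3L+μ) + ε)ⁿ for all n ≥ 1. -/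

import Mathlib

/-- `f` satisfies the local Polyak–Łojasiewicz condition at the local minimizer `xs`. -/
def LocalPL {d : ℕ} (f : EuclideanSpace ℝ (Fin d) → ℝ) (xs : EuclideanSpace ℝ (Fin d)) : Prop :=
  ∃ U : Set (EuclideanSpace ℝ (Fin d)), IsOpen U ∧ xs ∈ U ∧
    ∃ ν : ℝ, 0 < ν ∧ ∀ x ∈ U, 2 * ν * (f x - f xs) ≤ ‖gradient f x‖ ^ 2

/-- `x : ℕ → ℝ^d` is a sequence of NAG iterates for `f` with step size `α` and momentum `β`. -/
def IsNAG {d : ℕ} (f : EuclideanSpace ℝ (Fin d) → ℝ) (α β : ℝ)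
    (x : ℕ → EuclideanSpace ℝ (Fin d)) : Prop :=
  ∀ n : ℕ, 1 ≤ n →
    x (n + 1) = (x n + β • (x n - x (n - 1)))
      - α • gradient f (x n + β • (x n - x (n - 1)))

/-- `𝒮`: the set of local minimizers of `f` at the same level as `xs`. -/
def minSet {d : ℕ} (f : EuclideanSpace ℝ (Fin d) → ℝ) (xs : EuclideanSpace ℝ (Fin d)) :
    Set (EuclideanSpace ℝ (Fin d)) :=
  {p | IsLocalMin f p ∧ f p = f xs}

theorem exists_complex_roots_norm_le {q t : ℝ} (hq0 : 0 < q) (hq1 : q ≤ 1)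
    (ht1 : (q ^ 2 - 1) / 3 ≤ t) (ht2 : t ≤ 1 - q ^ 2) :
    ∃ z₁ z₂ : ℂ, z₁ + z₂ = ((2 / (1 + q) * t : ℝ) : ℂ) ∧
      z₁ * z₂ = (((1 - q) / (1 + q) * t : ℝ) : ℂ) ∧ ‖z₁‖ ≤ 1 - q ∧ ‖z₂‖ ≤ 1 - q := by
  obtain ⟨τ, hτ1, hτ2, hτ⟩ : ∃ τ : ℝ, -1 / 3 ≤ τ ∧ τ ≤ 1 ∧ t = (1 - q ^ 2) * τ := by
    rcases hq1.eq_or_lt with rfl | hq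
    · exact ⟨0, by norm_num, by norm_num, by linarith⟩
    · have h : 0 < 1 - q ^ 2 := by nlinarith
      refine ⟨t / (1 - q ^ 2), ?_, ?_, by field_simp⟩
      · rw [le_div_iff₀ h]; linarith
      · rw [div_le_one h]; exact ht2
  obtain ⟨w₁, w₂, hs, hp, hw₁, hw₂⟩ : ∃ w₁ w₂ : ℂ, w₁ + w₂ = ((2 * τ : ℝ) : ℂ) ∧
      w₁ * w₂ = (τ : ℂ) ∧ ‖w₁‖ ≤ 1 ∧ ‖w₂‖ ≤ 1 := by
    rcases le_total 0 τ with h0 | h0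
    · have hs : √(τ - τ ^ 2) ^ 2 = τ - τ ^ 2 := Real.sq_sqrt (by nlinarith)
      refine ⟨⟨τ, √(τ - τ ^ 2)⟩, ⟨τ, -√(τ - τ ^ 2)⟩, ?_, ?_, ?_, ?_⟩
      · apply Complex.ext <;> simp; ring
      · apply Complex.ext <;> simp
        · nlinarith
        · ring
      all_goals
        rw [← sq_le_one_iff₀ (norm_nonneg _), Complex.sq_norm, Complex.normSq_mk]
        nlinarith
    · have hs : √(τ ^ 2 - τ) ^ 2 = τ ^ 2 - τ := Real.sq_sqrt (by nlinarith)
      have hs0 := Real.sqrt_nonneg (τ ^ 2 - τ)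
      have hs1 : √(τ ^ 2 - τ) ≤ 1 + τ := Real.sqrt_le_iff.2 ⟨by linarith, by nlinarith⟩
      refine ⟨((τ + √(τ ^ 2 - τ) : ℝ) : ℂ), ((τ - √(τ ^ 2 - τ) : ℝ) : ℂ), ?_, ?_, ?_, ?_⟩
      · rw [← Complex.ofReal_add]; congr 1; ring
      · rw [← Complex.ofReal_mul]; congr 1; nlinarith
      all_goals
        rw [Complex.norm_real, Real.norm_eq_abs, abs_le]
        constructor <;> linarith
  have hq : (1 + q) ≠ 0 := by positivity
  refine ⟨((1 - q : ℝ) : ℂ) * w₁, ((1 - q : ℝ) : ℂ) * w₂, ?_, ?_, ?_, ?_⟩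
  · rw [← mul_add, hs, ← Complex.ofReal_mul, hτ]; congr 1; field_simp; ring
  · rw [mul_mul_mul_comm, hp, ← Complex.ofReal_mul, ← Complex.ofReal_mul, hτ]
    congr 1; field_simp; ring
  all_goals
    rw [norm_mul, Complex.norm_real, Real.norm_eq_abs, abs_of_nonneg (by linarith)]
    exact mul_le_of_le_one_right (by linarith) ‹_›

/-- A Lyapunov function for the two-dimensional linear system which the momentum method induces
on an eigendirection of the Hessian with eigenvalue `l`; here `a` stands for the component of the
velocity and `b` for the component of the gradient. -/
theorem exists_scalar_lyapunov {q α β l r : ℝ} (hq0 : 0 < q) (hq1 : q ≤ 1) (hα : 0 ≤ α)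
    (hβ : β = (1 - q) / (1 + q)) (hl : l = 0 ∨ (q ^ 2 ≤ α * l ∧ α * l ≤ (4 - q ^ 2) / 3))
    (hr : 1 - q < r) :
    ∃ (N : ℝ → ℝ → ℝ) (C : ℝ), 0 ≤ C ∧ (∀ a b, 0 ≤ N a b) ∧
      (∀ a b a' b', N (a + a') (b + b') ≤ N a b + N a' b') ∧
      (∀ a b, N a b ≤ C * (|a| + |b|)) ∧
      (∀ a b, |a| ≤ C * N a b) ∧
      (∀ a b, |b| ≤ C * (N a b + if l = 0 then |b| else 0)) ∧
      (∀ a b, N (β * (a - α * (l * a)) - α * b) (b + l * (β * (a - α * (l * a)) - α * b)) ≤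
        r * N a b + C * if l = 0 then |b| else 0) := by
  have hβ0 : 0 ≤ β := hβ ▸ div_nonneg (by linarith) (by linarith)
  have hβr : β ≤ r := by
    have : β ≤ 1 - q := by
      rw [hβ]; exact div_le_self (by linarith) (by linarith)
    linarith
  by_cases h0 : l = 0
  · refine ⟨fun a _ => |a|, 1 + α, by positivity, fun a _ => abs_nonneg a,
      fun a _ a' _ => abs_add_le a a', fun a b => ?_, fun a b => ?_, fun a b => ?_, fun a b => ?_⟩
    · nlinarith [abs_nonneg a, abs_nonneg b]
    · nlinarith [abs_nonneg a]
    · simp only [h0, if_true]; nlinarith [abs_nonneg a, abs_nonneg b]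
    · simp only [h0, if_true, zero_mul, mul_zero, sub_zero]
      have h1 := abs_sub (β * a) (α * b)
      rw [abs_mul, abs_mul, abs_of_nonneg hβ0, abs_of_nonneg hα] at h1
      nlinarith [abs_nonneg a, abs_nonneg b]
  · obtain ⟨hl1, hl2⟩ := hl.resolve_left h0
    obtain ⟨z₁, z₂, hs, hp, hz₁, hz₂⟩ := exists_complex_roots_norm_le (t := 1 - α * l) hq0 hq1
      (by linarith) (by linarith)
    have hs' : z₁ + z₂ = (((1 + β) * (1 - α * l) : ℝ) : ℂ) := by
      rw [hs, hβ]; congr 1; field_simp; ring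
    rw [← hβ] at hp
    have hl' : (l : ℂ) ≠ 0 := by exact_mod_cast h0
    obtain ⟨K, hK, hKr⟩ : ∃ K : ℝ, 0 < K ∧ 1 / K = r - (1 - q) :=
      ⟨1 / (r - (1 - q)), by rw [one_div_pos]; linarith, by rw [one_div_one_div]⟩
    have hK1 : 1 = K * (r - (1 - q)) := by rw [← hKr]; field_simp
    set Q : ℝ → ℝ → ℂ := fun a b => b - l * a with hQ
    set P : ℝ → ℝ → ℂ := fun a b => b - z₁ * Q a b with hP
    have hQle : ∀ a b, ‖Q a b‖ ≤ |b| + |l| * |a| := fun a b => by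
      refine (norm_sub_le _ _).trans ?_
      simp
    have hz₁' : ‖z₁‖ ≤ 1 := hz₁.trans (by linarith)
    have hPle : ∀ a b, ‖P a b‖ ≤ |b| + ‖Q a b‖ := fun a b => by
      refine (norm_sub_le _ _).trans ?_
      rw [norm_mul, Complex.norm_real, Real.norm_eq_abs]
      nlinarith [norm_nonneg (Q a b)]
    have hble : ∀ a b, |b| ≤ ‖P a b‖ + ‖Q a b‖ := fun a b => by
      have : (b : ℂ) = P a b + z₁ * Q a b := by simp only [hP]; ring
      rw [← Real.norm_eq_abs, ← Complex.norm_real, this]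
      refine (norm_add_le _ _).trans ?_
      rw [norm_mul]
      nlinarith [norm_nonneg (Q a b)]
    have hale : ∀ a b, |a| ≤ |l|⁻¹ * (|b| + ‖Q a b‖) := fun a b => by
      have : (l : ℂ) * a = b - Q a b := by simp only [hQ]; ring
      have h1 : |l| * |a| ≤ |b| + ‖Q a b‖ := by
        rw [← abs_mul, ← Real.norm_eq_abs, ← Complex.norm_real, Complex.ofReal_mul, this]
        refine (norm_sub_le _ _).trans ?_
        simp
      rw [inv_mul_eq_div, le_div_iff₀ (abs_pos.2 h0)]
      linarith
    have hKi : 0 < K⁻¹ := by positivity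
    have hPN : ∀ a b, ‖P a b‖ ≤ K⁻¹ * (‖Q a b‖ + K * ‖P a b‖) := fun a b => by
      have : K⁻¹ * (‖Q a b‖ + K * ‖P a b‖) = K⁻¹ * ‖Q a b‖ + ‖P a b‖ := by field_simp
      rw [this]
      have : 0 ≤ K⁻¹ * ‖Q a b‖ := by positivity
      linarith
    have hQN : ∀ a b, ‖Q a b‖ ≤ ‖Q a b‖ + K * ‖P a b‖ := fun a b => by
      have : 0 ≤ K * ‖P a b‖ := by positivity
      linarith
    have hN0 : ∀ a b, 0 ≤ ‖Q a b‖ + K * ‖P a b‖ := fun a b => by positivity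
    have hbN : ∀ a b, |b| ≤ (K⁻¹ + 1) * (‖Q a b‖ + K * ‖P a b‖) := fun a b => by
      linarith [hble a b, hPN a b, hQN a b]
    have haN : ∀ a b, |a| ≤ |l|⁻¹ * (K⁻¹ + 2) * (‖Q a b‖ + K * ‖P a b‖) := fun a b => by
      refine (hale a b).trans ?_
      rw [mul_assoc]
      gcongr
      linarith [hbN a b, hQN a b]
    have hC1 : 0 ≤ |l|⁻¹ * (K⁻¹ + 2) := by positivity
    have hC2 : 0 ≤ (1 + 2 * K) * (1 + |l|) := by positivity
    refine ⟨fun a b => ‖Q a b‖ + K * ‖P a b‖,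
      |l|⁻¹ * (K⁻¹ + 2) + (K⁻¹ + 1) + (1 + 2 * K) * (1 + |l|), by positivity, hN0,
      fun a b a' b' => ?_, fun a b => ?_, fun a b => ?_, fun a b => ?_, fun a b => ?_⟩
    · have e1 : Q (a + a') (b + b') = Q a b + Q a' b' := by
        simp only [hQ]; push_cast; ring
      have e2 : P (a + a') (b + b') = P a b + P a' b' := by
        simp only [hP, e1]; push_cast; ring
      simp only [e1, e2]
      have h1 := norm_add_le (Q a b) (Q a' b')
      have h2 := mul_le_mul_of_nonneg_left (norm_add_le (P a b) (P a' b')) hK.le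
      linarith
    · have h1 := mul_le_mul_of_nonneg_left (hPle a b) hK.le
      have h2 : ‖Q a b‖ + K * ‖P a b‖ ≤ (1 + 2 * K) * (|b| + |l| * |a|) := by
        nlinarith [hQle a b, mul_nonneg (abs_nonneg l) (abs_nonneg a)]
      have h3 : (1 + 2 * K) * (|b| + |l| * |a|) ≤ (1 + 2 * K) * (1 + |l|) * (|a| + |b|) := by
        rw [mul_assoc]
        gcongr
        nlinarith [abs_nonneg l, abs_nonneg a, abs_nonneg b,
          mul_nonneg (abs_nonneg l) (abs_nonneg b)]
      refine h2.trans (h3.trans ?_)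
      gcongr
      linarith
    · refine (haN a b).trans (mul_le_mul_of_nonneg_right ?_ (hN0 a b))
      linarith
    · rw [if_neg h0, add_zero]
      refine (hbN a b).trans (mul_le_mul_of_nonneg_right ?_ (hN0 a b))
      linarith
    · have e1 : Q (β * (a - α * (l * a)) - α * b)
          (b + l * (β * (a - α * (l * a)) - α * b)) = z₁ * Q a b + P a b := by
        simp only [hP, hQ]; push_cast; ring
      have e2 : P (β * (a - α * (l * a)) - α * b)
          (b + l * (β * (a - α * (l * a)) - α * b)) = z₂ * P a b := by
        simp only [hP, hQ]
        push_cast at hs' hp ⊢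
        linear_combination (-(b : ℂ)) * hs' + ((b : ℂ) - l * a) * hp
      simp only [e1, e2, if_neg h0, mul_zero, add_zero]
      have h1 := norm_add_le (z₁ * Q a b) (P a b)
      rw [norm_mul] at h1 ⊢
      have h2 : ‖z₁‖ * ‖Q a b‖ ≤ (1 - q) * ‖Q a b‖ := by gcongr
      have h3 : K * (‖z₂‖ * ‖P a b‖) ≤ K * ((1 - q) * ‖P a b‖) := by gcongr
      have h4 : (1 - q) * ‖Q a b‖ ≤ r * ‖Q a b‖ := by gcongr
      have h5 : ‖P a b‖ = K * (r - (1 - q)) * ‖P a b‖ := by rw [← hK1, one_mul]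
      linarith

section Lyapunov

open Filter Topology Metric
open scoped InnerProductSpace

variable {E : Type*} [NormedAddCommGroup E] [InnerProductSpace ℝ E] {ι : Type*} [Fintype ι]

/-- A Lyapunov function for the linearized momentum method, in terms of the velocity `v` and the
gradient `w`. -/
theorem exists_linear_lyapunov (b : OrthonormalBasis ι ℝ E) (l : ι → ℝ) (H : E →L[ℝ] E)
    (hH : ∀ i v, ⟪b i, H v⟫_ℝ = l i * ⟪b i, v⟫_ℝ)
    {q α β r : ℝ} (hq0 : 0 < q) (hq1 : q ≤ 1) (hα : 0 ≤ α) (hβ : β = (1 - q) / (1 + q))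
    (hl : ∀ i, l i = 0 ∨ (q ^ 2 ≤ α * l i ∧ α * l i ≤ (4 - q ^ 2) / 3)) (hr : 1 - q < r) :
    ∃ (N : E → E → ℝ) (C : ℝ), 0 ≤ C ∧ (∀ v w, 0 ≤ N v w) ∧
      (∀ v w v' w', N (v + v') (w + w') ≤ N v w + N v' w') ∧
      (∀ v w, N v w ≤ C * (‖v‖ + ‖w‖)) ∧
      (∀ v w, ‖v‖ ≤ C * N v w) ∧
      (∀ v w, ‖w‖ ≤ C * (N v w + ∑ i, if l i = 0 then |⟪b i, w⟫_ℝ| else 0)) ∧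
      (∀ v w, N (β • (v - α • H v) - α • w) (w + H (β • (v - α • H v) - α • w)) ≤
        r * N v w + C * ∑ i, if l i = 0 then |⟪b i, w⟫_ℝ| else 0) := by
  choose N C hC hN0 hadd hle ha hb hstep using fun i =>
    exists_scalar_lyapunov (r := r) hq0 hq1 hα hβ (hl i) hr
  have hCS : ∀ i, C i ≤ ∑ j, C j := fun i =>
    Finset.single_le_sum (f := C) (fun j _ => hC j) (Finset.mem_univ i)
  have hin : ∀ i v, |⟪b i, v⟫_ℝ| ≤ ‖v‖ := fun i v => by
    simpa using abs_real_inner_le_norm (b i) v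
  have hnorm : ∀ v, ‖v‖ ≤ ∑ i, |⟪b i, v⟫_ℝ| := fun v => by
    conv_lhs => rw [← b.sum_repr' v]
    refine (norm_sum_le _ _).trans (Finset.sum_le_sum fun i _ => ?_)
    simp [norm_smul]
  have hind : ∀ i w, 0 ≤ if l i = 0 then |⟪b i, w⟫_ℝ| else 0 := fun i w => by
    split_ifs <;> positivity
  refine ⟨fun v w => ∑ i, N i ⟪b i, v⟫_ℝ ⟪b i, w⟫_ℝ, ∑ i, C i,
    Finset.sum_nonneg fun i _ => hC i, fun v w => Finset.sum_nonneg fun i _ => hN0 i _ _,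
    fun v w v' w' => ?_, fun v w => ?_, fun v w => ?_, fun v w => ?_, fun v w => ?_⟩
  · rw [← Finset.sum_add_distrib]
    refine Finset.sum_le_sum fun i _ => ?_
    rw [inner_add_right, inner_add_right]
    exact hadd i _ _ _ _
  · rw [Finset.sum_mul]
    refine Finset.sum_le_sum fun i _ => (hle i _ _).trans ?_
    exact mul_le_mul_of_nonneg_left (add_le_add (hin i v) (hin i w)) (hC i)
  · rw [Finset.mul_sum]
    refine (hnorm v).trans (Finset.sum_le_sum fun i _ => (ha i _ ⟪b i, w⟫_ℝ).trans ?_)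
    exact mul_le_mul_of_nonneg_right (hCS i) (hN0 i _ _)
  · rw [← Finset.sum_add_distrib, Finset.mul_sum]
    refine (hnorm w).trans (Finset.sum_le_sum fun i _ => (hb i ⟪b i, v⟫_ℝ _).trans ?_)
    exact mul_le_mul_of_nonneg_right (hCS i) (add_nonneg (hN0 i _ _) (hind i w))
  · rw [Finset.mul_sum, Finset.mul_sum, ← Finset.sum_add_distrib]
    refine Finset.sum_le_sum fun i _ => ?_
    have e : ⟪b i, β • (v - α • H v) - α • w⟫_ℝ =
        β * (⟪b i, v⟫_ℝ - α * (l i * ⟪b i, v⟫_ℝ)) - α * ⟪b i, w⟫_ℝ := by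
      simp only [inner_sub_right, inner_smul_right, hH]
    rw [inner_add_right, hH, e]
    refine (hstep i _ _).trans ?_
    have := mul_le_mul_of_nonneg_right (hCS i) (hind i w)
    linarith

/-- Near a point where the distance to the zero set of `g` is bounded by a multiple of `‖g‖`, the
component of `g` along the kernel of the derivative is negligible. -/
theorem eventually_kernel_component_le (b : OrthonormalBasis ι ℝ E) (l : ι → ℝ) {H : E →L[ℝ] E}
    (hH : ∀ i v, ⟪b i, H v⟫_ℝ = l i * ⟪b i, v⟫_ℝ) {g : E → E} {p : E}
    (hg : HasStrictFDerivAt g H p) {c : ℝ} (hc : 0 ≤ c)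
    (heb : ∀ η > 0, ∀ᶠ x in 𝓝 p, ∃ z ∈ ball p η, g z = 0 ∧ ‖x - z‖ ≤ c * ‖g x‖)
    {δ : ℝ} (hδ : 0 < δ) :
    ∀ᶠ x in 𝓝 p, (∑ i, if l i = 0 then |⟪b i, g x⟫_ℝ| else 0) ≤ δ * ‖g x‖ := by
  set δ' : ℝ := δ / (Fintype.card ι * c + 1) with hδ'
  have hδ'0 : 0 < δ' := by positivity
  have h1 := hg.isLittleO.def hδ'0
  rw [Metric.eventually_nhds_iff_ball] at h1
  obtain ⟨η, hη, h1⟩ := h1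
  filter_upwards [heb η hη, ball_mem_nhds p hη] with x ⟨z, hz, hz0, hxz⟩ hx
  have h2 : ‖g x - g z - H (x - z)‖ ≤ δ' * ‖x - z‖ :=
    h1 (x, z) (by rw [← ball_prod_same]; exact ⟨hx, hz⟩)
  rw [hz0, sub_zero] at h2
  have h3 : ∀ i, (if l i = 0 then |⟪b i, g x⟫_ℝ| else 0) ≤ δ' * (c * ‖g x‖) := by
    intro i
    split_ifs with hi
    · have : ⟪b i, g x⟫_ℝ = ⟪b i, g x - H (x - z)⟫_ℝ := by
        rw [inner_sub_right, hH, hi, zero_mul, sub_zero]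
      rw [this]
      calc |⟪b i, g x - H (x - z)⟫_ℝ| ≤ ‖g x - H (x - z)‖ := by
            simpa using abs_real_inner_le_norm (b i) (g x - H (x - z))
        _ ≤ δ' * ‖x - z‖ := h2
        _ ≤ _ := by gcongr
    · positivity
  calc _ ≤ ∑ _i : ι, δ' * (c * ‖g x‖) := Finset.sum_le_sum fun i _ => h3 i
    _ = δ' * (Fintype.card ι * c) * ‖g x‖ := by
      rw [Finset.sum_const, Finset.card_univ, nsmul_eq_mul]; ring
    _ ≤ δ' * (Fintype.card ι * c + 1) * ‖g x‖ := by gcongr; linarith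
    _ = δ * ‖g x‖ := by rw [hδ']; field_simp

/-- A Lyapunov function for the momentum method near a zero of `g`, where the current point is `x`
and the previous one is `y`. -/
theorem exists_local_lyapunov (b : OrthonormalBasis ι ℝ E) (l : ι → ℝ) {H : E →L[ℝ] E}
    (hH : ∀ i v, ⟪b i, H v⟫_ℝ = l i * ⟪b i, v⟫_ℝ) {g : E → E} {p : E} (hp : g p = 0)
    (hg : HasStrictFDerivAt g H p) {c : ℝ} (hc : 0 ≤ c)
    (heb : ∀ η > 0, ∀ᶠ x in 𝓝 p, ∃ z ∈ ball p η, g z = 0 ∧ ‖x - z‖ ≤ c * ‖g x‖)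
    {q α β R : ℝ} (hq0 : 0 < q) (hq1 : q ≤ 1) (hα : 0 ≤ α) (hβ : β = (1 - q) / (1 + q))
    (hl : ∀ i, l i = 0 ∨ (q ^ 2 ≤ α * l i ∧ α * l i ≤ (4 - q ^ 2) / 3)) (hR : 1 - q < R) :
    ∃ (N : E → E → ℝ) (C : ℝ), 0 ≤ C ∧ (∀ v w, 0 ≤ N v w) ∧
      (∀ v w, N v w ≤ C * (‖v‖ + ‖w‖)) ∧ (∀ v w, ‖v‖ ≤ C * N v w) ∧
      ∀ᶠ z : E × E in 𝓝 (p, p), ∀ x y x' : E, z = (x, y) →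
        x' = (x + β • (x - y)) - α • g (x + β • (x - y)) →
        ‖g x‖ ≤ C * N (x - y) (g x) ∧
        N (x' - x) (g x') ≤ R * N (x - y) (g x) := by
  obtain ⟨r, hr, hrR⟩ := exists_between hR
  obtain ⟨N, C, hC, hN0, hadd, hle, hv, hw, hstep⟩ :=
    exists_linear_lyapunov b l H hH hq0 hq1 hα hβ hl hr
  have hβ0 : 0 ≤ β := hβ ▸ div_nonneg (by linarith) (by linarith)
  have hβ1 : β ≤ 1 := by
    rw [hβ, div_le_one (by linarith)]; linarith
  set M : ℝ := 1 + ‖H‖ * α + α with hM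
  have hM0 : 0 ≤ M := by positivity
  set D : ℝ := 1 + C + C * (2 * C) + C * (3 * M) * (3 * C) with hD
  have hD0 : 0 < D := by positivity
  obtain ⟨δ, hδ, hδ1, hδ2, hδ3⟩ : ∃ δ : ℝ, 0 < δ ∧ δ ≤ 1 ∧ δ * C ≤ 1 / 2 ∧
      δ * (C * (2 * C) + C * (3 * M) * (3 * C)) ≤ R - r := by
    have hm : 0 < min (1 / 2) (R - r) := lt_min (by norm_num) (by linarith)
    have e : min (1 / 2) (R - r) / D * D = min (1 / 2) (R - r) := by field_simp
    have hδ0 : 0 < min (1 / 2) (R - r) / D := by positivity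
    have hA : 0 ≤ C * (2 * C) + C * (3 * M) * (3 * C) := by positivity
    have hle1 := min_le_left (1 / 2) (R - r)
    have hle2 := min_le_right (1 / 2) (R - r)
    refine ⟨min (1 / 2) (R - r) / D, hδ0, ?_, ?_, ?_⟩
    · nlinarith
    · nlinarith
    · nlinarith
  refine ⟨N, 2 * C, by positivity, hN0, fun v w => (hle v w).trans ?_,
    fun v w => (hv v w).trans ?_, ?_⟩
  · nlinarith [mul_nonneg hC (add_nonneg (norm_nonneg v) (norm_nonneg w))]
  · nlinarith [mul_nonneg hC (hN0 v w)]
  have hstrict := hg.isLittleO.def hδ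
  have hgc : ContinuousAt g p := hg.continuousAt
  have hyc : Tendsto (fun z : E × E => z.1 + β • (z.1 - z.2)) (𝓝 (p, p)) (𝓝 p) := by
    have : ContinuousAt (fun z : E × E => z.1 + β • (z.1 - z.2)) (p, p) := by fun_prop
    simpa [ContinuousAt] using this
  have hxc : Tendsto (fun z : E × E => z.1) (𝓝 (p, p)) (𝓝 p) := continuousAt_fst
  have hx'c : Tendsto (fun z : E × E => z.1 + β • (z.1 - z.2) - α • g (z.1 + β • (z.1 - z.2)))
      (𝓝 (p, p)) (𝓝 p) := by
    have := hyc.sub ((hgc.tendsto.comp hyc).const_smul α)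
    simpa [hp] using this
  have h1 := (hyc.prodMk_nhds hxc).eventually hstrict
  have h2 := (hx'c.prodMk_nhds hxc).eventually hstrict
  have h3 := hxc.eventually (eventually_kernel_component_le b l hH hg hc heb hδ)
  filter_upwards [h1, h2, h3] with z h1 h2 h3
  rintro x y x' rfl hx'
  dsimp only at h1 h2 h3
  rw [← hx'] at h2
  set v := x - y with hvdef
  have hN := hN0 v (g x)
  have hgN : ‖g x‖ ≤ 2 * C * N v (g x) := by
    have h4 := hw v (g x)
    have h5 := mul_le_mul_of_nonneg_left h3 hC
    nlinarith [norm_nonneg (g x)]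
  have hvN := hv v (g x)
  refine ⟨hgN, ?_⟩
  set s := ‖v‖ + ‖g x‖ with hs
  have hvs : ‖v‖ ≤ s := by linarith [norm_nonneg (g x)]
  have hs0 : 0 ≤ s := by positivity
  rw [add_sub_cancel_left] at h1
  set e := g (x + β • v) - g x - H (β • v) with he
  set a := β • (v - α • H v) - α • g x with ha
  have hel : ‖e‖ ≤ δ * s := by
    refine h1.trans ?_
    rw [norm_smul, Real.norm_of_nonneg hβ0]
    have : β * ‖v‖ ≤ s := (mul_le_of_le_one_left (norm_nonneg _) hβ1).trans hvs
    gcongr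
  have hv' : x' - x = a + (-α) • e := by
    rw [hx', ha, he, map_smul]
    module
  have hal : ‖a‖ ≤ M * s := by
    have h6 : ‖v - α • H v‖ ≤ (1 + ‖H‖ * α) * ‖v‖ := by
      refine (norm_sub_le _ _).trans ?_
      rw [norm_smul, Real.norm_of_nonneg hα]
      nlinarith [mul_le_mul_of_nonneg_left (H.le_opNorm v) hα]
    have h7 : ‖a‖ ≤ ‖v - α • H v‖ + α * ‖g x‖ := by
      refine (norm_sub_le _ _).trans ?_
      rw [norm_smul, norm_smul, Real.norm_of_nonneg hα, Real.norm_of_nonneg hβ0]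
      nlinarith [norm_nonneg (v - α • H v)]
    have h8 : (1 + ‖H‖ * α) * ‖v‖ ≤ (1 + ‖H‖ * α) * s := by gcongr
    have h9 : α * ‖g x‖ ≤ α * s := by
      have : ‖g x‖ ≤ s := by linarith [norm_nonneg v]
      gcongr
    rw [hM]
    linarith
  have hαe : ‖(-α) • e‖ ≤ α * (δ * s) := by
    rw [norm_smul, norm_neg, Real.norm_of_nonneg hα]
    gcongr
  have hαM : α ≤ M := by
    have : 0 ≤ ‖H‖ * α := by positivity
    rw [hM]
    linarith
  have hv'l : ‖x' - x‖ ≤ 2 * M * s := by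
    have h6 : α * (δ * s) ≤ M * (1 * s) := by gcongr
    rw [hv']
    linarith [norm_add_le a ((-α) • e)]
  have hgx' : g x' = (g x + H a) + (H ((-α) • e) + (g x' - g x - H (x' - x))) := by
    rw [hv', map_add]
    abel
  have herr : ‖H ((-α) • e) + (g x' - g x - H (x' - x))‖ ≤
      ‖H‖ * (α * (δ * s)) + δ * (2 * M * s) := by
    refine (norm_add_le _ _).trans (add_le_add ?_ ?_)
    · exact (H.le_opNorm _).trans (by gcongr)
    · exact h2.trans (by gcongr)
  have hκ := mul_le_mul_of_nonneg_left h3 hC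
  have hlast := hle ((-α) • e) (H ((-α) • e) + (g x' - g x - H (x' - x)))
  have hmain := hadd a (g x + H a) ((-α) • e) (H ((-α) • e) + (g x' - g x - H (x' - x)))
  rw [← hv', ← hgx'] at hmain
  have hst := hstep v (g x)
  have hb1 : C * (‖(-α) • e‖ + ‖H ((-α) • e) + (g x' - g x - H (x' - x))‖) ≤
      C * (δ * (3 * M) * s) := by
    refine mul_le_mul_of_nonneg_left ?_ hC
    have : (α + ‖H‖ * α) * (δ * s) ≤ M * (δ * s) :=
      mul_le_mul_of_nonneg_right (by linarith) (by positivity)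
    linarith
  have hs3 : s ≤ 3 * C * N v (g x) := by
    rw [hs]
    linarith
  have hb2 : C * (δ * (3 * M) * s) ≤ C * (δ * (3 * M) * (3 * C * N v (g x))) := by gcongr
  have hb3 : C * (δ * ‖g x‖) ≤ C * (δ * (2 * C * N v (g x))) := by gcongr
  have hb4 := mul_le_mul_of_nonneg_right hδ3 hN
  linarith

end Lyapunov

section ErrorBound

open Filter Topology Metric
open scoped InnerProductSpace

variable {E : Type*} [NormedAddCommGroup E] [InnerProductSpace ℝ E] [FiniteDimensional ℝ E]

/-- The Polyak–Łojasiewicz inequality implies a local error bound. -/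
theorem eventually_error_bound_of_pl {f : E → ℝ} {g : E → E} (hg : ∀ x, HasGradientAt f (g x) x)
    {p : E} (hmin : IsLocalMin f p) {ν : ℝ} (hν : 0 < ν)
    (hPL : ∀ᶠ x in 𝓝 p, 2 * ν * (f x - f p) ≤ ‖g x‖ ^ 2) :
    ∃ c : ℝ, 0 ≤ c ∧
      ∀ η > 0, ∀ᶠ x in 𝓝 p, ∃ z ∈ ball p η, g z = 0 ∧ ‖x - z‖ ≤ c * ‖g x‖ := by
  have hfd : ∀ x, HasFDerivAt f (InnerProductSpace.toDual ℝ E (g x)) x := fun x => hg x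
  have hfc : Continuous f := continuous_iff_continuousAt.2 fun x => (hfd x).continuousAt
  set k : ℝ := √(ν / 4) with hk
  have hk0 : 0 < k := Real.sqrt_pos.2 (by linarith)
  have hk2 : k ^ 2 = ν / 4 := Real.sq_sqrt (by linarith)
  refine ⟨k⁻¹ * (√(2 * ν))⁻¹, by positivity, fun η hη => ?_⟩
  obtain ⟨η₁, hη₁, hball⟩ := Metric.eventually_nhds_iff_ball.1 (hPL.and hmin)
  set ρ : ℝ := min η η₁ / 2 with hρ
  have hρ0 : 0 < ρ := by positivity
  have hρη : ρ < η := by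
    have := min_le_left η η₁
    rw [hρ]; linarith
  have hρη₁ : ρ < η₁ := by
    have := min_le_right η η₁
    rw [hρ]; linarith
  have hsmall : ∀ᶠ x in 𝓝 p, √(f x - f p) + k * dist x p < k * ρ := by
    have : ContinuousAt (fun x => √(f x - f p) + k * dist x p) p := by fun_prop
    refine this.eventually_lt_const ?_
    simpa using mul_pos hk0 hρ0
  filter_upwards [hsmall, ball_mem_nhds p hρ0] with x hx hxb
  set φ : E → ℝ := fun z => √(f z - f p) + k * ‖x - z‖ with hφ
  have hφc : Continuous φ := by fun_prop
  obtain ⟨z, hz, hzmin⟩ := (isCompact_closedBall p ρ).exists_isMinOn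
    ⟨x, ball_subset_closedBall hxb⟩ hφc.continuousOn
  have hzx : φ z ≤ √(f x - f p) := by
    have := hzmin (ball_subset_closedBall hxb)
    simpa [hφ] using this
  have hsz := Real.sqrt_nonneg (f z - f p)
  have hzb : z ∈ ball p ρ := by
    rw [mem_ball]
    have h1 : dist z p ≤ ‖x - z‖ + dist x p := by
      rw [← dist_eq_norm, dist_comm x z]
      exact dist_triangle _ _ _
    have h2 : k * ‖x - z‖ ≤ √(f x - f p) := by simp only [hφ] at hzx; linarith
    have h3 := mul_le_mul_of_nonneg_left h1 hk0.le
    exact lt_of_mul_lt_mul_left (by linarith) hk0.le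
  have hzη₁ : z ∈ ball p η₁ := ball_subset_ball hρη₁.le hzb
  obtain ⟨hzPL, hzf⟩ := hball z hzη₁
  obtain ⟨hxPL, hxf⟩ := hball x (ball_subset_ball hρη₁.le hxb)
  have hzeq : f z = f p := by
    by_contra hne
    have hpos : 0 < f z - f p := sub_pos.2 (lt_of_le_of_ne hzf (Ne.symm hne))
    have hs0 : 0 < √(f z - f p) := Real.sqrt_pos.2 hpos
    have hs2 : √(f z - f p) ^ 2 = f z - f p := Real.sq_sqrt hpos.le
    -- compare `φ` along the ray in the direction of steepest descent
    set u : E := -g z with hu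
    have hline : HasDerivAt (fun t : ℝ => z + t • u) u 0 := by
      simpa using ((hasDerivAt_id (0 : ℝ)).smul_const u).const_add z
    have hfl : HasDerivAt (fun t : ℝ => f (z + t • u)) (-‖g z‖ ^ 2) 0 := by
      have h1 : HasFDerivAt f (InnerProductSpace.toDual ℝ E (g z)) (z + (0 : ℝ) • u) := by
        simpa using hfd z
      have h2 := h1.comp_hasDerivAt (0 : ℝ) hline
      simpa [hu, real_inner_self_eq_norm_sq, Function.comp_def] using h2
    have hsl : HasDerivAt (fun t : ℝ => √(f (z + t • u) - f p) + k * (t * ‖u‖))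
        (-‖g z‖ ^ 2 / (2 * √(f z - f p)) + k * ‖g z‖) 0 := by
      have h1 := (hfl.sub_const (f p)).sqrt (by simpa using hpos.ne')
      have h2 := ((hasDerivAt_id (0 : ℝ)).mul_const ‖u‖).const_mul k
      have h3 := h1.add h2
      simpa [hu] using! h3
    have hnonneg : 0 ≤ -‖g z‖ ^ 2 / (2 * √(f z - f p)) + k * ‖g z‖ := by
      refine ge_of_tendsto (hsl.tendsto_slope.mono_left
        (nhdsWithin_mono 0 (t := {0}ᶜ) (s := Set.Ioi 0) fun t ht => ne_of_gt ht)) ?_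
      have hmem : ∀ᶠ t : ℝ in 𝓝[>] 0, z + t • u ∈ ball p ρ := by
        refine nhdsWithin_le_nhds (hline.continuousAt.eventually_mem ?_)
        simpa using isOpen_ball.mem_nhds hzb
      filter_upwards [hmem, self_mem_nhdsWithin] with t ht ht0
      have ht0' : (0 : ℝ) < t := ht0
      rw [slope_def_field]
      have h1 : φ z ≤ φ (z + t • u) := hzmin (ball_subset_closedBall ht)
      have h2 : ‖x - (z + t • u)‖ ≤ ‖x - z‖ + t * ‖u‖ := by
        rw [← sub_sub]
        refine (norm_sub_le _ _).trans ?_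
        rw [norm_smul, Real.norm_of_nonneg ht0'.le]
      have h3 := mul_le_mul_of_nonneg_left h2 hk0.le
      refine div_nonneg ?_ (by linarith)
      simp only [hφ] at h1
      simp only [zero_smul, add_zero, zero_mul, mul_zero]
      linarith
    have hgz : 0 < ‖g z‖ := by
      have : 0 < ‖g z‖ ^ 2 := lt_of_lt_of_le (by positivity) hzPL
      exact (norm_nonneg _).lt_of_ne fun h => by simp [← h] at this
    have h1 : ‖g z‖ ≤ 2 * k * √(f z - f p) := by
      have h2 : ‖g z‖ ^ 2 / (2 * √(f z - f p)) ≤ k * ‖g z‖ := by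
        rw [neg_div] at hnonneg; linarith
      rw [div_le_iff₀ (by positivity)] at h2
      nlinarith
    have h2 : ‖g z‖ ^ 2 ≤ (2 * k * √(f z - f p)) ^ 2 := by gcongr
    have h3 : (2 * k * √(f z - f p)) ^ 2 = ν * (f z - f p) := by
      rw [mul_pow, mul_pow, hk2, hs2]; ring
    nlinarith
  refine ⟨z, ball_subset_ball hρη.le hzb, ?_, ?_⟩
  · have hloc : IsLocalMin f z := by
      filter_upwards [isOpen_ball.mem_nhds hzη₁] with y hy
      rw [hzeq]
      exact (hball y hy).2
    have := hloc.hasFDerivAt_eq_zero (hfd z)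
    simpa using this
  · have h1 : k * ‖x - z‖ ≤ √(f x - f p) := by
      have : φ z = k * ‖x - z‖ := by simp [hφ, hzeq]
      linarith
    have h2 : √(2 * ν) * √(f x - f p) ≤ ‖g x‖ := by
      rw [← Real.sqrt_mul (by linarith)]
      exact Real.sqrt_le_iff.2 ⟨norm_nonneg _, hxPL⟩
    have h3 : 0 < √(2 * ν) := Real.sqrt_pos.2 (by linarith)
    rw [mul_assoc, ← div_eq_inv_mul, ← div_eq_inv_mul, le_div_iff₀ hk0, le_div_iff₀ h3]
    nlinarith

end ErrorBound

section Convergence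

open Filter Topology Metric
open scoped InnerProductSpace

variable {E : Type*} [NormedAddCommGroup E] [InnerProductSpace ℝ E] [CompleteSpace E]
  {ι : Type*} [Fintype ι]

/-- Local linear convergence of the momentum method for a vector field `g` which satisfies a local
error bound near a zero `p`. -/
theorem exists_nhds_momentum_converges (b : OrthonormalBasis ι ℝ E) (l : ι → ℝ) {H : E →L[ℝ] E}
    (hH : ∀ i v, ⟪b i, H v⟫_ℝ = l i * ⟪b i, v⟫_ℝ) {g : E → E} (hgc : Continuous g) {p : E}
    (hp : g p = 0) (hg : HasStrictFDerivAt g H p) {c : ℝ} (hc : 0 ≤ c)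
    (heb : ∀ η > 0, ∀ᶠ x in 𝓝 p, ∃ z ∈ ball p η, g z = 0 ∧ ‖x - z‖ ≤ c * ‖g x‖)
    {q α β R : ℝ} (hq0 : 0 < q) (hq1 : q ≤ 1) (hα : 0 ≤ α) (hβ : β = (1 - q) / (1 + q))
    (hl : ∀ i, l i = 0 ∨ (q ^ 2 ≤ α * l i ∧ α * l i ≤ (4 - q ^ 2) / 3)) (hR : 1 - q < R)
    (hR1 : R < 1) {η : ℝ} (hη : 0 < η) :
    ∃ U : Set E, IsOpen U ∧ p ∈ U ∧ ∃ C : ℝ, 0 < C ∧ ∀ x : ℕ → E, x 0 ∈ U → x 1 ∈ U →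
      (∀ n, 1 ≤ n → x (n + 1) = (x n + β • (x n - x (n - 1))) -
        α • g (x n + β • (x n - x (n - 1)))) →
      ∃ x' ∈ ball p η, g x' = 0 ∧ Tendsto x atTop (𝓝 x') ∧
        ∀ n, 1 ≤ n → ‖x n - x'‖ ≤ C * (‖x 1 - x'‖ + ‖x 0 - x'‖) * R ^ n := by
  obtain ⟨N, C, hC, hN0, hNle, hvN, hev⟩ :=
    exists_local_lyapunov b l hH hp hg hc heb hq0 hq1 hα hβ hl hR
  have hR0 : 0 < R := by linarith
  have h1R : 0 < 1 - R := by linarith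
  obtain ⟨η₁, hη₁, hstep⟩ := Metric.eventually_nhds_iff_ball.1 hev
  obtain ⟨η₂, hη₂, hlip⟩ := Metric.eventually_nhds_iff_ball.1 (hg.isLittleO.def one_pos)
  set ρ : ℝ := min η (min η₁ η₂) / 2 with hρ
  have hm1 := min_le_left η (min η₁ η₂)
  have hm2 := min_le_right η (min η₁ η₂)
  have hm3 := min_le_left η₁ η₂
  have hm4 := min_le_right η₁ η₂
  have hm0 : 0 < min η (min η₁ η₂) := by positivity
  have hρ0 : 0 < ρ := by positivity
  have hρη : ρ < η := by rw [hρ]; linarith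
  have hρη₁ : ρ < η₁ := by rw [hρ]; linarith
  have hρη₂ : ρ < η₂ := by rw [hρ]; linarith
  set D : ℝ := C / (1 - R) with hD
  have hD0 : 0 ≤ D := by positivity
  have hDC : (C + D) * R ≤ D := by
    have : D * (1 - R) = C := by rw [hD]; field_simp
    nlinarith
  -- the initial points are so close to `p` that the iterates cannot leave the ball of radius `ρ`
  have hini : ∀ᶠ z : E × E in 𝓝 (p, p),
      ‖z.2 - p‖ + D * (C * (‖z.2 - z.1‖ + ‖g z.2‖)) < ρ := by
    have : ContinuousAt (fun z : E × E => ‖z.2 - p‖ + D * (C * (‖z.2 - z.1‖ + ‖g z.2‖)))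
        (p, p) := by fun_prop
    refine this.eventually_lt_const ?_
    simpa [hp] using hρ0
  obtain ⟨η₃, hη₃, hini⟩ := Metric.eventually_nhds_iff_ball.1 hini
  set C' : ℝ := D * (C * (2 + ‖H‖)) + 1 with hC'
  refine ⟨ball p (min η₃ ρ), isOpen_ball, mem_ball_self (by positivity), C' / R, by positivity,
    fun x hx0 hx1 hx => ?_⟩
  have hx0ρ : x 0 ∈ ball p ρ := ball_subset_ball (min_le_right _ _) hx0
  have hinix : ‖x 1 - p‖ + D * (C * (‖x 1 - x 0‖ + ‖g (x 1)‖)) < ρ :=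
    hini (x 0, x 1) (by
      rw [← ball_prod_same]
      exact ⟨ball_subset_ball (min_le_left _ _) hx0, ball_subset_ball (min_le_left _ _) hx1⟩)
  set V : ℕ → ℝ := fun n => N (x (n + 1) - x n) (g (x (n + 1))) with hV
  have hV0 : ∀ n, 0 ≤ V n := fun n => hN0 _ _
  have hVini : V 0 ≤ C * (‖x 1 - x 0‖ + ‖g (x 1)‖) := hNle _ _
  have hloc : ∀ n, x n ∈ ball p ρ → x (n + 1) ∈ ball p ρ →
      ‖g (x (n + 1))‖ ≤ C * V n ∧ V (n + 1) ≤ R * V n := by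
    intro n h1 h2
    refine hstep (x (n + 1), x n) ?_ _ _ (x (n + 2)) rfl ?_
    · rw [← ball_prod_same]
      exact ⟨ball_subset_ball hρη₁.le h2, ball_subset_ball hρη₁.le h1⟩
    · simpa using hx (n + 1) (by omega)
  have hmem : ∀ n, ‖x (n + 1) - p‖ + D * V n ≤ ‖x 1 - p‖ + D * V 0 → x (n + 1) ∈ ball p ρ := by
    intro n hn
    rw [mem_ball_iff_norm]
    have h1 := mul_le_mul_of_nonneg_left hVini hD0
    have h2 := mul_nonneg hD0 (hV0 n)
    linarith
  have hind : ∀ n, x n ∈ ball p ρ ∧ ‖x (n + 1) - p‖ + D * V n ≤ ‖x 1 - p‖ + D * V 0 ∧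
      V n ≤ R ^ n * V 0 := by
    intro n
    induction n with
    | zero => exact ⟨hx0ρ, le_rfl, by simp⟩
    | succ n ih =>
      obtain ⟨i1, i2, i3⟩ := ih
      have h1 := hmem n i2
      obtain ⟨-, s3⟩ := hloc n i1 h1
      have s4 : ‖x (n + 2) - x (n + 1)‖ ≤ C * V (n + 1) := hvN _ _
      refine ⟨h1, ?_, ?_⟩
      · have t1 : ‖x (n + 2) - p‖ ≤ ‖x (n + 2) - x (n + 1)‖ + ‖x (n + 1) - p‖ := by
          rw [← sub_add_sub_cancel (x (n + 2)) (x (n + 1)) p]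
          exact norm_add_le _ _
        have t2 := mul_le_mul_of_nonneg_left s3 (add_nonneg hC hD0)
        have t3 := mul_le_mul_of_nonneg_right hDC (hV0 n)
        linarith
      · rw [pow_succ']
        nlinarith
  have hmem' : ∀ n, x n ∈ ball p ρ := fun n => (hind n).1
  have hdist : ∀ n, dist (x (n + 1)) (x (n + 1 + 1)) ≤ C * V 0 * R ^ n := by
    intro n
    have h1 : ‖x (n + 2) - x (n + 1)‖ ≤ C * V (n + 1) := hvN _ _
    rw [dist_comm, dist_eq_norm]
    have h2 := (hind (n + 1)).2.2
    have h3 : R ^ (n + 1) * V 0 ≤ R ^ n * V 0 :=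
      mul_le_mul_of_nonneg_right (pow_le_pow_of_le_one hR0.le hR1.le (by omega)) (hV0 0)
    have h4 := mul_le_mul_of_nonneg_left (h2.trans h3) hC
    linarith
  obtain ⟨x', hx'⟩ := cauchySeq_tendsto_of_complete
    (cauchySeq_of_le_geometric R (C * V 0) hR1 hdist)
  have hlim : Tendsto x atTop (𝓝 x') := (tendsto_add_atTop_iff_nat 1).1 hx'
  have hx'ρ : x' ∈ closedBall p ρ := isClosed_closedBall.mem_of_tendsto hlim
    (Eventually.of_forall fun n => ball_subset_closedBall (hmem' n))
  have hgx' : g x' = 0 := by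
    refine tendsto_nhds_unique ((hgc.tendsto x').comp hx') ?_
    have h0 : Tendsto (fun n : ℕ => C * (R ^ n * V 0)) atTop (𝓝 0) := by
      simpa using ((tendsto_pow_atTop_nhds_zero_of_lt_one hR0.le hR1).mul_const (V 0)).const_mul C
    refine squeeze_zero_norm (fun n => ?_) h0
    exact (hloc n (hmem' _) (hmem' _)).1.trans (mul_le_mul_of_nonneg_left (hind n).2.2 hC)
  refine ⟨x', closedBall_subset_ball hρη hx'ρ, hgx', hlim, fun n hn => ?_⟩
  obtain ⟨m, rfl⟩ : ∃ m, n = m + 1 := ⟨n - 1, by omega⟩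
  have hd := dist_le_of_le_geometric_of_tendsto R (C * V 0) hR1 hdist hx' m
  rw [dist_eq_norm] at hd
  have hg1 : ‖g (x 1)‖ ≤ (1 + ‖H‖) * ‖x 1 - x'‖ := by
    have h1 : ‖g (x 1) - g x' - H (x 1 - x')‖ ≤ 1 * ‖x 1 - x'‖ :=
      hlip (x 1, x') (by
        rw [← ball_prod_same]
        exact ⟨ball_subset_ball hρη₂.le (hmem' 1), closedBall_subset_ball hρη₂ hx'ρ⟩)
    rw [hgx', sub_zero] at h1
    have h2 := norm_add_le (g (x 1) - H (x 1 - x')) (H (x 1 - x'))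
    rw [sub_add_cancel] at h2
    have h3 := H.le_opNorm (x 1 - x')
    linarith
  have hv1 : ‖x 1 - x 0‖ ≤ ‖x 1 - x'‖ + ‖x 0 - x'‖ := by
    rw [← sub_sub_sub_cancel_right (x 1) (x 0) x']
    exact norm_sub_le _ _
  set s := ‖x 1 - x'‖ + ‖x 0 - x'‖ with hs
  have hs0 : 0 ≤ s := by positivity
  have hV1 : V 0 ≤ C * ((2 + ‖H‖) * s) := by
    refine hVini.trans (mul_le_mul_of_nonneg_left ?_ hC)
    have : (1 + ‖H‖) * ‖x 1 - x'‖ ≤ (1 + ‖H‖) * s := by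
      gcongr
      linarith [norm_nonneg (x 0 - x')]
    linarith
  calc ‖x (m + 1) - x'‖ ≤ C * V 0 * R ^ m / (1 - R) := hd
    _ = D * V 0 * R ^ m := by rw [hD]; ring
    _ ≤ D * (C * ((2 + ‖H‖) * s)) * R ^ m := by gcongr
    _ ≤ C' * s * R ^ m := by
      have : D * (C * ((2 + ‖H‖) * s)) ≤ C' * s := by
        rw [hC']
        linarith
      gcongr
    _ = C' / R * s * R ^ (m + 1) := by rw [pow_succ]; field_simp

end Convergence

section Gradient

open scoped InnerProductSpace

variable {E : Type*} [NormedAddCommGroup E] [InnerProductSpace ℝ E] [CompleteSpace E]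

theorem contDiff_gradient {f : E → ℝ} (hf : ContDiff ℝ 2 f) : ContDiff ℝ 1 (gradient f) :=
  (InnerProductSpace.toDual ℝ E).symm.toContinuousLinearEquiv.contDiff.comp
    (hf.fderiv_right (m := 1) (by norm_num))

theorem isSymmetric_fderiv_gradient {f : E → ℝ} (hf : ContDiff ℝ 2 f) (x : E) :
    (fderiv ℝ (gradient f) x : E →ₗ[ℝ] E).IsSymmetric := by
  have key : ∀ v w, ⟪fderiv ℝ (gradient f) x v, w⟫_ℝ = fderiv ℝ (fderiv ℝ f) x v w := by
    intro v w
    have hd : DifferentiableAt ℝ (gradient f) x :=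
      (contDiff_gradient hf).differentiable (by norm_num) x
    have h1 : HasFDerivAt (fun y => InnerProductSpace.toDual ℝ E (gradient f y))
        ((InnerProductSpace.toDual ℝ E).toContinuousLinearEquiv.toContinuousLinearMap.comp
          (fderiv ℝ (gradient f) x)) x :=
      (InnerProductSpace.toDual ℝ E).toContinuousLinearEquiv.hasFDerivAt.comp x hd.hasFDerivAt
    have h2 : (fun y => InnerProductSpace.toDual ℝ E (gradient f y)) = fderiv ℝ f :=
      funext fun y => toDual_gradient
    rw [h2] at h1
    rw [h1.fderiv]
    rfl
  have hsymm : IsSymmSndFDerivAt ℝ f x := hf.contDiffAt.isSymmSndFDerivAt (by simp)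
  intro v w
  rw [ContinuousLinearMap.coe_coe, key, real_inner_comm, key]
  exact hsymm v w

end Gradient

/-- Under the hypotheses of Statement 1, with the optimal parameters
`α = 4/(3L+μ)` and `β = (√(3L+μ) − 2√μ)/(√(3L+μ) + 2√μ)`, for every sufficiently small
`ε > 0` there are an open neighborhood `U` of `xs` and `C_ε > 0` such that for all
`x⁰, x¹ ∈ U` the NAG iterates converge to some `x' ∈ 𝒮` with
`‖xⁿ − x'‖ ≤ C_ε (‖x¹ − x'‖ + ‖x⁰ − x'‖)((√(3L+μ) − 2√μ)/√(3L+μ) + ε)ⁿ` for all `n ≥ 1`. -/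
theorem stmt_2 {d : ℕ} (f : EuclideanSpace ℝ (Fin d) → ℝ) (hf : ContDiff ℝ 2 f)
    (hbdd : BddBelow (Set.range f)) (xs : EuclideanSpace ℝ (Fin d)) (hmin : IsLocalMin f xs)
    (hPL : LocalPL f xs) (μ L : ℝ) (hμ : 0 < μ) (hμL : μ ≤ L)
    (hspec : ∃ V : Set (EuclideanSpace ℝ (Fin d)), IsOpen V ∧ xs ∈ V ∧
      ∀ p ∈ V, p ∈ minSet f xs → ∀ c : ℝ, c ≠ 0 →
        (∃ v, v ≠ 0 ∧ fderiv ℝ (gradient f) p v = c • v) → c ∈ Set.Icc μ L) :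
    ∃ ε₀ : ℝ, 0 < ε₀ ∧ ∀ ε : ℝ, 0 < ε → ε < ε₀ →
      ∃ U : Set (EuclideanSpace ℝ (Fin d)), IsOpen U ∧ xs ∈ U ∧
        ∃ C : ℝ, 0 < C ∧
          ∀ x : ℕ → EuclideanSpace ℝ (Fin d), x 0 ∈ U → x 1 ∈ U →
            IsNAG f (4 / (3 * L + μ))
              ((Real.sqrt (3 * L + μ) - 2 * Real.sqrt μ) /
                (Real.sqrt (3 * L + μ) + 2 * Real.sqrt μ)) x →
            ∃ x' ∈ minSet f xs,
              Filter.Tendsto x Filter.atTop (nhds x') ∧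
              ∀ n : ℕ, 1 ≤ n →
                ‖x n - x'‖ ≤ C * (‖x 1 - x'‖ + ‖x 0 - x'‖) *
                  ((Real.sqrt (3 * L + μ) - 2 * Real.sqrt μ) / Real.sqrt (3 * L + μ) + ε) ^ n := by
  obtain ⟨V, -, hxV, hV⟩ := hspec
  obtain ⟨W, hW, hxW, ν, hν, hPL⟩ := hPL
  have hm0 : 0 < √μ := Real.sqrt_pos.2 hμ
  have hS : 0 < 3 * L + μ := by linarith
  have hs0 : 0 < √(3 * L + μ) := Real.sqrt_pos.2 hS
  have hm2 : √μ ^ 2 = μ := Real.sq_sqrt hμ.le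
  have hs2 : √(3 * L + μ) ^ 2 = 3 * L + μ := Real.sq_sqrt hS.le
  set m := √μ
  set s := √(3 * L + μ)
  set q : ℝ := 2 * m / s with hq
  have hq0 : 0 < q := by positivity
  have hq1 : q ≤ 1 := by
    rw [hq, div_le_one hs0]
    exact le_of_sq_le_sq (by nlinarith) hs0.le
  have hβ : (s - 2 * m) / (s + 2 * m) = (1 - q) / (1 + q) := by
    rw [hq]; field_simp
  have hrate : (s - 2 * m) / s = 1 - q := by
    rw [hq]; field_simp
  have hα : 0 ≤ 4 / (3 * L + μ) := by positivity
  have hq2 : q ^ 2 = 4 / (3 * L + μ) * μ := by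
    rw [hq, div_pow, mul_pow, hm2, hs2]; ring
  have hgrad : ∀ x, HasGradientAt f (gradient f x) x := fun x =>
    (hf.differentiable (by norm_num) x).hasGradientAt
  have hgC := contDiff_gradient hf
  have hsymm := isSymmetric_fderiv_gradient hf xs
  have hn : Module.finrank ℝ (EuclideanSpace ℝ (Fin d)) = d := finrank_euclideanSpace_fin
  have hH : ∀ i v, inner ℝ (hsymm.eigenvectorBasis hn i) (fderiv ℝ (gradient f) xs v) =
      hsymm.eigenvalues hn i * inner ℝ (hsymm.eigenvectorBasis hn i) v := by
    intro i v
    have h := hsymm (hsymm.eigenvectorBasis hn i) v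
    rw [hsymm.apply_eigenvectorBasis, inner_smul_left] at h
    simpa using h.symm
  have hl : ∀ i, hsymm.eigenvalues hn i = 0 ∨
      (q ^ 2 ≤ 4 / (3 * L + μ) * hsymm.eigenvalues hn i ∧
        4 / (3 * L + μ) * hsymm.eigenvalues hn i ≤ (4 - q ^ 2) / 3) := by
    intro i
    refine or_iff_not_imp_left.2 fun h0 => ?_
    obtain ⟨h1, h2⟩ := hV xs hxV ⟨hmin, rfl⟩ _ h0 ⟨hsymm.eigenvectorBasis hn i,
      (hsymm.eigenvectorBasis hn).orthonormal.ne_zero i,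
      hsymm.apply_eigenvectorBasis hn i⟩
    have h3 : (4 - q ^ 2) / 3 = 4 / (3 * L + μ) * L := by
      rw [hq2]; field_simp; ring
    rw [h3, hq2]
    exact ⟨mul_le_mul_of_nonneg_left h1 hα, mul_le_mul_of_nonneg_left h2 hα⟩
  have hgxs : gradient f xs = 0 := by
    rw [gradient, hmin.fderiv_eq_zero, map_zero]
  obtain ⟨c, hc, heb⟩ := eventually_error_bound_of_pl hgrad hmin hν
    (Filter.eventually_of_mem (hW.mem_nhds hxW) hPL)
  obtain ⟨η, hη, hball⟩ := Metric.eventually_nhds_iff_ball.1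
    ((Filter.eventually_of_mem (hW.mem_nhds hxW) hPL).and hmin)
  refine ⟨q, hq0, fun ε hε hεq => ?_⟩
  rw [hrate, hβ]
  obtain ⟨U, hU, hxU, C, hC, hconv⟩ := exists_nhds_momentum_converges
    (hsymm.eigenvectorBasis hn) (hsymm.eigenvalues hn) hH hgC.continuous hgxs
    (hgC.contDiffAt.hasStrictFDerivAt (by norm_num)) hc heb hq0 hq1 hα rfl hl
    (R := 1 - q + ε) (by linarith) (by linarith) hη
  refine ⟨U, hU, hxU, C, hC, fun x hx0 hx1 hx => ?_⟩
  obtain ⟨x', hx'η, hgx', hlim, hbound⟩ := hconv x hx0 hx1 hx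
  refine ⟨x', ⟨?_, ?_⟩, hlim, hbound⟩
  all_goals
    have hle : f x' ≤ f xs := by
      have := (hball x' hx'η).1
      rw [hgx', norm_zero] at this
      nlinarith
  · filter_upwards [Metric.isOpen_ball.mem_nhds hx'η] with y hy
    exact hle.trans (hball y hy).2
  · exact hle.antisymm (hball x' hx'η).2
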